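/- Fix a probability measure π on Θ. For every posterior distribution ω ↦ ρ_ω and every positive real constant λ, P[ ρ_ω(R) ] ≤ ( 1 − exp( −N^{-1} ∫_0^λ π_{exp(−βR)}(R) dβ − N^{-1} P[ K(ρ_ω, π_{exp(−λ r(·,ω))}) ] ) ) / ( 1 − exp(−λ/N) ) ≤ ( N (1 − exp(−λ/N)) )^{-1} ( ∫_0^λ π_{exp(−βR)}(R) dβ + P[ K(ρ_ω, π_{exp(−λ r(·,ω))}) ] ), where moreover ∫_0^λ π_{exp(−βR)}(R) dβ = −log π[exp(−λR)]. -/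

import Mathlib

open MeasureTheory ProbabilityTheory

/-- `Φ_a(p) = -a⁻¹ log(1 - (1 - e^{-a}) p)` for `a ≠ 0`, and `Φ_0(p) = p`. -/
noncomputable def Phi (a p : ℝ) : ℝ :=
  if a = 0 then p else -a⁻¹ * Real.log (1 - (1 - Real.exp (-a)) * p)

/-- `Φ_a⁻¹(q) = (1 - e^{-aq})/(1 - e^{-a})` for `a ≠ 0`, and `Φ_0⁻¹(q) = q`. -/
noncomputable def PhiInv (a q : ℝ) : ℝ :=
  if a = 0 then q else (1 - Real.exp (-(a * q))) / (1 - Real.exp (-a))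

/-- Kullback–Leibler divergence `K(ρ,π) = ∫ log (dρ/dπ) dρ` (as a real number;
meaningful under `KLFin ρ π`). -/
noncomputable def KL {Θ : Type*} [MeasurableSpace Θ] (ρ π : Measure Θ) : ℝ :=
  ∫ θ, Real.log ((ρ.rnDeriv π θ).toReal) ∂ρ

/-- Finiteness of the Kullback–Leibler divergence: `ρ ≪ π` and `log (dρ/dπ)`
is `ρ`-integrable. -/
def KLFin {Θ : Type*} [MeasurableSpace Θ] (ρ π : Measure Θ) : Prop :=
  ρ ≪ π ∧ Integrable (fun θ => Real.log ((ρ.rnDeriv π θ).toReal)) ρ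

/-- The Gibbs measure `π_{exp h}` with density `exp h / π[exp h]` with respect to `π`. -/
noncomputable def Gibbs {Θ : Type*} [MeasurableSpace Θ] (π : Measure Θ) (h : Θ → ℝ) :
    Measure Θ :=
  (ENNReal.ofReal (∫ θ, Real.exp (h θ) ∂π))⁻¹ •
    π.withDensity (fun θ => ENNReal.ofReal (Real.exp (h θ)))

/-- Empirical error rate `r(θ,ω) = N⁻¹ ∑ᵢ 1[f_θ(X_i) ≠ Y_i]`. -/
noncomputable def empErr {𝒳 𝒴 Θ : Type*} [DecidableEq 𝒴] (N : ℕ)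
    (f : Θ → 𝒳 → 𝒴) (θ : Θ) (ω : Fin N → 𝒳 × 𝒴) : ℝ :=
  (N : ℝ)⁻¹ * ∑ i, if f θ (ω i).1 = (ω i).2 then 0 else 1

/-- Expected error rate `R(θ) = N⁻¹ ∑ᵢ P[f_θ(X_i) ≠ Y_i]`. -/
noncomputable def expErr {𝒳 𝒴 Θ : Type*} [MeasurableSpace 𝒳] [MeasurableSpace 𝒴] (N : ℕ)
    (P : Measure (Fin N → 𝒳 × 𝒴)) (f : Θ → 𝒳 → 𝒴) (θ : Θ) : ℝ :=
  (N : ℝ)⁻¹ * ∑ i, (P {ω | f θ (ω i).1 ≠ (ω i).2}).toReal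

section GibbsMeasures

variable {Θ Ω : Type*} [MeasurableSpace Θ] [MeasurableSpace Ω]

lemma integrable_exp_of_abs_le {μ : Measure Θ} [IsFiniteMeasure μ] {g : Θ → ℝ} {C : ℝ}
    (hg : Measurable g) (hC : ∀ θ, |g θ| ≤ C) : Integrable (fun θ => Real.exp (g θ)) μ :=
  Integrable.of_bound hg.exp.aestronglyMeasurable (Real.exp C) <| ae_of_all _ fun θ => by
    rw [Real.norm_eq_abs, Real.abs_exp]
    exact Real.exp_le_exp.2 ((le_abs_self _).trans (hC θ))

lemma integrable_of_abs_le {μ : Measure Θ} [IsFiniteMeasure μ] {g : Θ → ℝ} {C : ℝ}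
    (hg : Measurable g) (hC : ∀ θ, |g θ| ≤ C) : Integrable g μ :=
  Integrable.of_bound hg.aestronglyMeasurable C <| ae_of_all _ hC

lemma integral_const_add_mul_sub {μ : Measure Θ} [IsProbabilityMeasure μ] {g : Θ → ℝ}
    (hg : Integrable g μ) (a s m : ℝ) :
    ∫ θ, (a + s * (g θ - m)) ∂μ = a + s * (∫ θ, g θ ∂μ - m) := by
  have hsub : Integrable (fun θ => g θ - m) μ := hg.sub (integrable_const m)
  rw [integral_add (integrable_const a) (hsub.const_mul s), integral_const_mul,
    integral_sub hg (integrable_const m)]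
  simp

lemma gibbs_eq_tilted {π : Measure Θ} [NeZero π] {h : Θ → ℝ}
    (hexp : Integrable (fun θ => Real.exp (h θ)) π) : Gibbs π h = π.tilted h := by
  have hpos := integral_exp_pos hexp
  rw [Gibbs, Measure.tilted, ← withDensity_smul' _ _ (by simpa using hpos)]
  congr 1
  ext θ
  rw [Pi.smul_apply, smul_eq_mul, ENNReal.ofReal_div_of_pos hpos, mul_comm, div_eq_mul_inv]

lemma integral_le_log_integral_exp {μ : Measure Θ} [IsProbabilityMeasure μ] {g : Θ → ℝ}
    (hg : Integrable g μ) (hexp : Integrable (fun θ => Real.exp (g θ)) μ) :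
    ∫ θ, g θ ∂μ ≤ Real.log (∫ θ, Real.exp (g θ) ∂μ) := by
  rw [Real.le_log_iff_exp_le (integral_exp_pos hexp)]
  exact convexOn_exp.map_integral_le Real.continuous_exp.continuousOn isClosed_univ
    (by simp) hg hexp

/-- The Donsker–Varadhan inequality. -/
lemma integral_sub_log_integral_exp_le_integral_llr {ρ μ : Measure Θ} [IsProbabilityMeasure ρ]
    [IsProbabilityMeasure μ] {h : Θ → ℝ} (hac : ρ ≪ μ) (hint : Integrable (llr ρ μ) ρ)
    (hρ : Integrable h ρ) (hμ : Integrable (fun θ => Real.exp (h θ)) μ) :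
    ∫ θ, h θ ∂ρ - Real.log (∫ θ, Real.exp (h θ) ∂μ) ≤ ∫ θ, llr ρ μ θ ∂ρ := by
  have := isProbabilityMeasure_tilted hμ
  have h0 : 0 ≤ ∫ θ, llr ρ (μ.tilted h) θ ∂ρ := by
    rw [← InformationTheory.toReal_klDiv_of_measure_eq
      (hac.trans (absolutelyContinuous_tilted hμ)) (by simp)]
    exact ENNReal.toReal_nonneg
  rw [integral_llr_tilted_right hac hρ hμ hint] at h0
  linarith

lemma log_integral_exp_add_integral_tilted_sub_le {π : Measure Θ} [IsProbabilityMeasure π]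
    {v w : Θ → ℝ} {C D : ℝ} (hv : Measurable v) (hw : Measurable w)
    (hvC : ∀ θ, |v θ| ≤ C) (hwD : ∀ θ, |w θ| ≤ D) :
    Real.log (∫ θ, Real.exp (w θ) ∂π) + (∫ θ, v θ ∂(π.tilted w) - ∫ θ, w θ ∂(π.tilted w))
      ≤ Real.log (∫ θ, Real.exp (v θ) ∂π) := by
  have hwexp := integrable_exp_of_abs_le (μ := π) hw hwD
  have := isProbabilityMeasure_tilted hwexp
  have hvw : ∀ θ, |v θ - w θ| ≤ C + D := fun θ =>
    (abs_sub _ _).trans (add_le_add (hvC θ) (hwD θ))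
  have key := integral_le_log_integral_exp (μ := π.tilted w)
    (integrable_of_abs_le (hv.sub hw) hvw) (integrable_exp_of_abs_le (hv.sub hw) hvw)
  simp only [Pi.sub_apply] at key
  rw [integral_sub (integrable_of_abs_le hv hvC) (integrable_of_abs_le hw hwD),
    integral_exp_tilted, Real.log_div] at key
  · have heq : w + (fun θ => v θ - w θ) = v := by ext; simp
    simp only [heq] at key
    linarith
  · have heq : w + (fun θ => v θ - w θ) = v := by ext; simp
    simp only [heq]
    exact (integral_exp_pos (integrable_exp_of_abs_le hv hvC)).ne'
  · exact (integral_exp_pos hwexp).ne'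

lemma integral_add_log_sub_le_integral_llr_tilted {π ρ : Measure Θ} [IsProbabilityMeasure π]
    [IsProbabilityMeasure ρ] {v h : Θ → ℝ} {C D : ℝ} (hv : Measurable v) (hh : Measurable h)
    (hvC : ∀ θ, |v θ| ≤ C) (hhD : ∀ θ, |h θ| ≤ D)
    (hac : ρ ≪ π.tilted v) (hint : Integrable (llr ρ (π.tilted v)) ρ) :
    ∫ θ, h θ ∂ρ + Real.log (∫ θ, Real.exp (v θ) ∂π) + 1 - ∫ θ, Real.exp (v θ + h θ) ∂π
      ≤ ∫ θ, llr ρ (π.tilted v) θ ∂ρ := by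
  have hvexp := integrable_exp_of_abs_le (μ := π) hv hvC
  have := isProbabilityMeasure_tilted hvexp
  have hvh : Integrable (fun θ => Real.exp (v θ + h θ)) π :=
    integrable_exp_of_abs_le (hv.add hh) fun θ =>
      (abs_add_le _ _).trans (add_le_add (hvC θ) (hhD θ))
  have hpos := integral_exp_pos hvh
  have key := integral_sub_log_integral_exp_le_integral_llr hac hint
    (integrable_of_abs_le hh hhD) (integrable_exp_of_abs_le hh hhD)
  rw [integral_exp_tilted] at key
  simp only [Pi.add_apply] at key
  rw [Real.log_div hpos.ne' (integral_exp_pos hvexp).ne'] at key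
  linarith [Real.log_le_sub_one_of_pos hpos]

/-- A localized PAC-Bayesian inequality in expectation. -/
lemma integral_posterior_add_log_le_integral_llr {P : Measure Ω} [IsProbabilityMeasure P]
    {π : Measure Θ} [IsProbabilityMeasure π] {ρ : Kernel Ω Θ} [IsMarkovKernel ρ]
    {u : Θ → Ω → ℝ} {h : Θ → ℝ} {C D : ℝ} (hu : Measurable (Function.uncurry u))
    (hh : Measurable h) (huC : ∀ θ ω, |u θ ω| ≤ C) (hhD : ∀ θ, |h θ| ≤ D)
    (hle : ∀ θ, ∫ ω, Real.exp (u θ ω + h θ) ∂P ≤ 1)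
    (hρ : ∀ᵐ ω ∂P, ρ ω ≪ π.tilted (u · ω) ∧ Integrable (llr (ρ ω) (π.tilted (u · ω))) (ρ ω))
    (hint : Integrable (fun ω => ∫ θ, llr (ρ ω) (π.tilted (u · ω)) θ ∂(ρ ω)) P) :
    ∫ ω, ∫ θ, h θ ∂(ρ ω) ∂P + Real.log (∫ θ, Real.exp (∫ ω, u θ ω ∂P) ∂π)
      ≤ ∫ ω, ∫ θ, llr (ρ ω) (π.tilted (u · ω)) θ ∂(ρ ω) ∂P := by
  set U : Θ → ℝ := fun θ => ∫ ω, u θ ω ∂P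
  have hUmeas : Measurable U := hu.stronglyMeasurable.integral_prod_right.measurable
  have hUC : ∀ θ, |U θ| ≤ C := fun θ => by
    simpa using norm_integral_le_of_norm_le_const (μ := P) (f := u θ) (ae_of_all _ (huC θ))
  have hUexp := integrable_exp_of_abs_le (μ := π) hUmeas hUC
  set G := π.tilted U
  have : IsProbabilityMeasure G := isProbabilityMeasure_tilted hUexp
  have hu_sec : ∀ ω, Measurable fun θ => u θ ω := fun ω => hu.comp measurable_prodMk_right
  have huG : Integrable (Function.uncurry u) (G.prod P) :=
    integrable_of_abs_le hu fun p => huC p.1 p.2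
  have hexpmeas : Measurable fun p : Θ × Ω => u p.1 p.2 + h p.1 :=
    hu.add (hh.comp measurable_fst)
  have hexpint : Integrable (fun p : Θ × Ω => Real.exp (u p.1 p.2 + h p.1)) (π.prod P) :=
    integrable_exp_of_abs_le hexpmeas fun p =>
      (abs_add_le _ _).trans (add_le_add (huC p.1 p.2) (hhD p.1))
  have hhint : Integrable (fun ω => ∫ θ, h θ ∂(ρ ω)) P :=
    integrable_of_abs_le (C := D) hh.stronglyMeasurable.integral_kernel.measurable fun ω => by
      simpa using norm_integral_le_of_norm_le_const (μ := ρ ω) (f := h) (ae_of_all _ hhD)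
  have hswapG : ∫ ω, ∫ θ, u θ ω ∂G ∂P = ∫ θ, U θ ∂G := (integral_integral_swap huG).symm
  have hswapπ : ∫ ω, ∫ θ, Real.exp (u θ ω + h θ) ∂π ∂P ≤ 1 := by
    rw [← integral_integral_swap (f := fun θ ω => Real.exp (u θ ω + h θ)) hexpint]
    calc ∫ θ, ∫ ω, Real.exp (u θ ω + h θ) ∂P ∂π ≤ ∫ _, (1 : ℝ) ∂π :=
          integral_mono hexpint.integral_prod_left (integrable_const _) hle
      _ = 1 := by simp
  set c := Real.log (∫ θ, Real.exp (U θ) ∂π) - ∫ θ, U θ ∂G + 1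
  have hpt : ∀ᵐ ω ∂P, (∫ θ, h θ ∂(ρ ω) + (∫ θ, u θ ω ∂G + c))
      - ∫ θ, Real.exp (u θ ω + h θ) ∂π ≤ ∫ θ, llr (ρ ω) (π.tilted (u · ω)) θ ∂(ρ ω) := by
    filter_upwards [hρ] with ω hω
    have h1 := integral_add_log_sub_le_integral_llr_tilted (hu_sec ω) hh (fun θ => huC θ ω) hhD
      hω.1 hω.2
    have h2 := log_integral_exp_add_integral_tilted_sub_le (π := π) (hu_sec ω) hUmeas
      (fun θ => huC θ ω) hUC
    linarith
  have huGint : Integrable (fun ω => ∫ θ, u θ ω ∂G) P := huG.integral_prod_right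
  have hexpint' : Integrable (fun ω => ∫ θ, Real.exp (u θ ω + h θ) ∂π) P :=
    hexpint.integral_prod_right
  have hcint : Integrable (fun ω => ∫ θ, u θ ω ∂G + c) P := huGint.add (integrable_const c)
  have hsum : Integrable (fun ω => ∫ θ, h θ ∂(ρ ω) + (∫ θ, u θ ω ∂G + c)) P := hhint.add hcint
  have hmono := integral_mono_ae (hsum.sub hexpint') hint hpt
  simp only [Pi.sub_apply] at hmono
  rw [integral_sub hsum hexpint', integral_add hhint hcint,
    integral_add huGint (integrable_const c)] at hmono
  simp only [hswapG, integral_const, probReal_univ, one_smul] at hmono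
  linarith

lemma intervalIntegral_integral_tilted_neg {π : Measure Θ} [IsProbabilityMeasure π] {g : Θ → ℝ}
    {C : ℝ} (hg : Measurable g) (hgC : ∀ θ, |g θ| ≤ C) (t : ℝ) :
    ∫ β in (0 : ℝ)..t, ∫ θ, g θ ∂(π.tilted fun θ => -(β * g θ))
      = -Real.log (∫ θ, Real.exp (-(t * g θ)) ∂π) := by
  have huniv : integrableExpSet (fun θ => -g θ) π = Set.univ := Set.eq_univ_of_forall fun β =>
    integrable_exp_of_abs_le (C := |β| * C) (hg.neg.const_mul β) fun θ => by
      rw [abs_mul, abs_neg]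
      exact mul_le_mul_of_nonneg_left (hgC θ) (abs_nonneg β)
  have han : AnalyticOnNhd ℝ (cgf (fun θ => -g θ) π) Set.univ := by
    simpa [huniv] using analyticOnNhd_cgf (X := fun θ => -g θ) (μ := π)
  have hderiv : ∀ β, ∫ θ, g θ ∂(π.tilted fun θ => -(β * g θ))
      = -deriv (cgf (fun θ => -g θ) π) β := fun β => by
    rw [← integral_tilted_mul_self (by simp [huniv]), integral_neg, neg_neg]
    simp only [mul_neg]
  simp_rw [hderiv]
  rw [intervalIntegral.integral_neg, intervalIntegral.integral_deriv_eq_sub]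
  · simp [cgf, mgf]
  · exact fun x _ => (han x trivial).differentiableAt
  · exact (han.deriv.continuousOn.mono (Set.subset_univ _)).intervalIntegrable

end GibbsMeasures

section ErrorRates

lemma empErr_mem_Icc {𝒳 𝒴 Θ : Type*} [DecidableEq 𝒴] {N : ℕ} {f : Θ → 𝒳 → 𝒴} (θ : Θ) (ω : Fin N → 𝒳 × 𝒴) :
    empErr N f θ ω ∈ Set.Icc (0 : ℝ) 1 := by
  have h0 : ∀ i : Fin N, (0 : ℝ) ≤ if f θ (ω i).1 = (ω i).2 then 0 else 1 := fun i => by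
    split_ifs <;> norm_num
  have h1 : ∑ i : Fin N, (if f θ (ω i).1 = (ω i).2 then (0 : ℝ) else 1) ≤ N := by
    calc _ ≤ ∑ _i : Fin N, (1 : ℝ) := Finset.sum_le_sum fun i _ => by split_ifs <;> norm_num
      _ = N := by simp
  refine ⟨mul_nonneg (by positivity) (Finset.sum_nonneg fun i _ => h0 i), ?_⟩
  rw [empErr, inv_mul_eq_div]
  exact div_le_one_of_le₀ h1 (by positivity)

variable {𝒳 𝒴 Θ : Type*} [MeasurableSpace 𝒳] [MeasurableSpace 𝒴] [Fintype 𝒴]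
  [MeasurableSingletonClass 𝒴] [MeasurableSpace Θ] {N : ℕ} {f : Θ → 𝒳 → 𝒴}

lemma measurableSet_error (hf : Measurable fun p : Θ × 𝒳 => f p.1 p.2) (i : Fin N) :
    MeasurableSet {p : Θ × (Fin N → 𝒳 × 𝒴) | f p.1 (p.2 i).1 ≠ (p.2 i).2} :=
  (measurableSet_eq_fun (by fun_prop) (by fun_prop)).compl

lemma measurable_expErr {P : Measure (Fin N → 𝒳 × 𝒴)} [SFinite P]
    (hf : Measurable fun p : Θ × 𝒳 => f p.1 p.2) : Measurable (expErr N P f) :=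
  (Finset.measurable_sum _ fun i _ =>
    (measurable_measure_prodMk_left (measurableSet_error hf i)).ennreal_toReal).const_mul _

variable [DecidableEq 𝒴]

lemma measurable_empErr (hf : Measurable fun p : Θ × 𝒳 => f p.1 p.2) :
    Measurable fun p : Θ × (Fin N → 𝒳 × 𝒴) => empErr N f p.1 p.2 :=
  (Finset.measurable_sum _ fun i _ => Measurable.ite
    (by simpa only [Set.compl_ofPred, ne_eq, not_not] using (measurableSet_error hf i).compl) measurable_const measurable_const).const_mul _

lemma integral_empErr {P : Measure (Fin N → 𝒳 × 𝒴)} [IsProbabilityMeasure P]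
    (hf : Measurable fun p : Θ × 𝒳 => f p.1 p.2) (θ : Θ) :
    ∫ ω, empErr N f θ ω ∂P = expErr N P f θ := by
  have hind : ∀ i : Fin N, (fun ω : Fin N → 𝒳 × 𝒴 => if f θ (ω i).1 = (ω i).2 then (0 : ℝ) else 1)
      = Set.indicator {ω | f θ (ω i).1 ≠ (ω i).2} 1 := fun i => by
    ext ω
    by_cases h : f θ (ω i).1 = (ω i).2 <;> simp [h]
  have hms : ∀ i : Fin N, MeasurableSet {ω : Fin N → 𝒳 × 𝒴 | f θ (ω i).1 ≠ (ω i).2} := fun i =>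
    measurable_prodMk_left (measurableSet_error hf i)
  simp only [empErr, expErr]
  rw [integral_const_mul, integral_finsetSum]
  · congr 1
    refine Finset.sum_congr rfl fun i _ => ?_
    rw [hind, integral_indicator_one (hms i)]
    rfl
  · intro i _
    rw [hind]
    exact (integrable_const (1 : ℝ)).indicator (hms i)

lemma expErr_mem_Icc {P : Measure (Fin N → 𝒳 × 𝒴)} [IsProbabilityMeasure P]
    (hf : Measurable fun p : Θ × 𝒳 => f p.1 p.2) (θ : Θ) : expErr N P f θ ∈ Set.Icc (0 : ℝ) 1 := by
  have hint : Integrable (fun ω => empErr N f θ ω) P :=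
    integrable_of_abs_le (C := 1) ((measurable_empErr hf).comp measurable_prodMk_left) fun ω => by
      rw [abs_of_nonneg (empErr_mem_Icc θ ω).1]
      exact (empErr_mem_Icc θ ω).2
  rw [← integral_empErr hf]
  refine ⟨integral_nonneg fun ω => (empErr_mem_Icc θ ω).1, ?_⟩
  simpa using integral_mono hint (integrable_const (1 : ℝ)) fun ω => (empErr_mem_Icc θ ω).2

lemma integral_exp_neg_mul_empErr {Ps : Fin N → Measure (𝒳 × 𝒴)}
    [∀ i, IsProbabilityMeasure (Ps i)] (hf : Measurable fun p : Θ × 𝒳 => f p.1 p.2)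
    (t : ℝ) (θ : Θ) :
    ∫ ω, Real.exp (-(t * empErr N f θ ω)) ∂(Measure.pi Ps)
      = ∏ i, (1 - (1 - Real.exp (-(t / N)))
          * ((Measure.pi Ps) {ω | f θ (ω i).1 ≠ (ω i).2}).toReal) := by
  have hms : MeasurableSet {z : 𝒳 × 𝒴 | f θ z.1 ≠ z.2} :=
    (measurableSet_eq_fun (f := fun z : 𝒳 × 𝒴 => f θ z.1)
      (hf.comp (measurable_const.prodMk measurable_fst)) measurable_snd).compl
  have hprod : ∀ ω : Fin N → 𝒳 × 𝒴, Real.exp (-(t * empErr N f θ ω))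
      = ∏ i, (1 - (1 - Real.exp (-(t / N))) *
          Set.indicator {z : 𝒳 × 𝒴 | f θ z.1 ≠ z.2} (1 : 𝒳 × 𝒴 → ℝ) (ω i)) := fun ω => by
    rw [empErr, ← mul_assoc, Finset.mul_sum, ← Finset.sum_neg_distrib, Real.exp_sum]
    refine Finset.prod_congr rfl fun i _ => ?_
    by_cases h : f θ (ω i).1 = (ω i).2 <;> simp [h, div_eq_mul_inv]
  simp_rw [hprod]
  rw [integral_fintype_prod_eq_prod (μ := Ps) fun _ z => 1 - (1 - Real.exp (-(t / N))) *
    Set.indicator {z : 𝒳 × 𝒴 | f θ z.1 ≠ z.2} (1 : 𝒳 × 𝒴 → ℝ) z]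
  refine Finset.prod_congr rfl fun i _ => ?_
  have hPs : (Measure.pi Ps) {ω | f θ (ω i).1 ≠ (ω i).2} = Ps i {z : 𝒳 × 𝒴 | f θ z.1 ≠ z.2} :=
    (measurePreserving_eval Ps i).measure_preimage hms.nullMeasurableSet
  have hind : Integrable (Set.indicator {z : 𝒳 × 𝒴 | f θ z.1 ≠ z.2} (1 : 𝒳 × 𝒴 → ℝ)) (Ps i) :=
    (integrable_const (1 : ℝ)).indicator hms
  rw [integral_sub (integrable_const _) (hind.const_mul _),
    integral_const_mul, integral_indicator_one hms, hPs]
  simp [Measure.real]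

lemma prod_one_sub_mul_le {ι : Type*} (s : Finset ι) {p : ι → ℝ} {c m : ℝ}
    (hp : ∀ i ∈ s, c * p i ≤ 1) (hm : 0 < 1 - c * m) :
    ∏ i ∈ s, (1 - c * p i)
      ≤ (1 - c * m) ^ s.card * Real.exp (-(c / (1 - c * m) * ∑ i ∈ s, (p i - m))) := by
  rw [Finset.mul_sum, ← Finset.sum_neg_distrib, Real.exp_sum, ← Finset.prod_const,
    ← Finset.prod_mul_distrib]
  refine Finset.prod_le_prod (fun i hi => sub_nonneg.2 (hp i hi)) fun i _ => ?_
  calc 1 - c * p i = (1 - c * m) * (-(c / (1 - c * m) * (p i - m)) + 1) := by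
        field_simp
        ring
    _ ≤ _ := mul_le_mul_of_nonneg_left (Real.add_one_le_exp _) hm.le

/-- An exponential moment bound for the empirical error rate, linearised at `m`. -/
lemma integral_exp_neg_mul_empErr_add_le_one {Ps : Fin N → Measure (𝒳 × 𝒴)}
    [∀ i, IsProbabilityMeasure (Ps i)] (hN : 0 < N)
    (hf : Measurable fun p : Θ × 𝒳 => f p.1 p.2) {t c m : ℝ} (ht : 0 ≤ t)
    (hc : c = 1 - Real.exp (-(t / N))) (hm : 0 < 1 - c * m) (θ : Θ) :
    ∫ ω, Real.exp (-(t * empErr N f θ ω) +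
      (-(N * Real.log (1 - c * m)) + N * (c / (1 - c * m)) *
        (expErr N (Measure.pi Ps) f θ - m))) ∂(Measure.pi Ps) ≤ 1 := by
  have hN' : (N : ℝ) ≠ 0 := by positivity
  simp_rw [Real.exp_add (-(t * empErr N f θ _))]
  rw [integral_mul_const, integral_exp_neg_mul_empErr hf, ← hc]
  set p : Fin N → ℝ := fun i => ((Measure.pi Ps) {ω | f θ (ω i).1 ≠ (ω i).2}).toReal with hp
  have hc0 : 0 ≤ c := by
    rw [hc, sub_nonneg, Real.exp_le_one_iff, neg_nonpos]
    positivity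
  have hc1 : c ≤ 1 := by rw [hc]; linarith [Real.exp_pos (-(t / N))]
  have hle := prod_one_sub_mul_le Finset.univ (p := p) (c := c) (m := m)
    (fun i _ => mul_le_one₀ hc1 ENNReal.toReal_nonneg
      (ENNReal.toReal_le_of_le_ofReal zero_le_one (by simpa using prob_le_one))) hm
  have hsum : ∑ i, (p i - m) = N * (expErr N (Measure.pi Ps) f θ - m) := by
    rw [expErr, mul_sub, mul_inv_cancel_left₀ hN']
    simp [Finset.sum_sub_distrib, hp]
  have hpow : (1 - c * m) ^ N = Real.exp (N * Real.log (1 - c * m)) := by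
    rw [Real.exp_nat_mul, Real.exp_log hm]
  rw [hsum, Finset.card_univ, Fintype.card_fin, hpow, ← Real.exp_add] at hle
  refine (mul_le_mul_of_nonneg_right hle (Real.exp_pos _).le).trans ?_
  rw [← Real.exp_add, Real.exp_le_one_iff]
  apply le_of_eq
  ring

end ErrorRates

/-- Non-random (localized) bound (Theorem `thm2.5` of Catoni): for every posterior `ρ`
and `λ > 0`,
`P[ρ(R)] ≤ (1 - exp(-N⁻¹∫₀^λ π_{exp(-βR)}(R) dβ - N⁻¹ P[K(ρ, π_{exp(-λ r)})]))/(1 - exp(-λ/N))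
        ≤ (N(1-exp(-λ/N)))⁻¹ (∫₀^λ π_{exp(-βR)}(R) dβ + P[K(ρ, π_{exp(-λ r)})])`,
with `∫₀^λ π_{exp(-βR)}(R) dβ = -log π[exp(-λR)]`. -/
theorem statement_6 {𝒳 𝒴 Θ : Type*} [MeasurableSpace 𝒳] [MeasurableSpace 𝒴]
    [Fintype 𝒴] [DecidableEq 𝒴] [MeasurableSingletonClass 𝒴] [MeasurableSpace Θ]
    (N : ℕ) (hN : 0 < N)
    (Ps : Fin N → Measure (𝒳 × 𝒴)) [∀ i, IsProbabilityMeasure (Ps i)]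
    (P : Measure (Fin N → 𝒳 × 𝒴)) [IsProbabilityMeasure P] (hP : P = Measure.pi Ps)
    (f : Θ → 𝒳 → 𝒴) (hf : Measurable fun p : Θ × 𝒳 => f p.1 p.2)
    (π : Measure Θ) [IsProbabilityMeasure π] (lam : ℝ) (hlam : 0 < lam)
    (ρ : Kernel (Fin N → 𝒳 × 𝒴) Θ) [IsMarkovKernel ρ]
    (hρ : ∀ᵐ ω ∂P, KLFin (ρ ω) (Gibbs π (fun θ' => -(lam * empErr N f θ' ω))))
    (hKLint : Integrable
      (fun ω => KL (ρ ω) (Gibbs π (fun θ' => -(lam * empErr N f θ' ω)))) P) :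
    (∫ ω, (∫ θ, expErr N P f θ ∂(ρ ω)) ∂P
        ≤ (1 - Real.exp
            (-(N : ℝ)⁻¹ * (∫ β in (0 : ℝ)..lam,
                ∫ θ, expErr N P f θ ∂(Gibbs π (fun θ' => -(β * expErr N P f θ'))))
             - (N : ℝ)⁻¹ *
                ∫ ω, KL (ρ ω) (Gibbs π (fun θ' => -(lam * empErr N f θ' ω))) ∂P))
          / (1 - Real.exp (-(lam / N))))
    ∧ ((1 - Real.exp
            (-(N : ℝ)⁻¹ * (∫ β in (0 : ℝ)..lam,
                ∫ θ, expErr N P f θ ∂(Gibbs π (fun θ' => -(β * expErr N P f θ'))))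
             - (N : ℝ)⁻¹ *
                ∫ ω, KL (ρ ω) (Gibbs π (fun θ' => -(lam * empErr N f θ' ω))) ∂P))
          / (1 - Real.exp (-(lam / N)))
        ≤ ((N : ℝ) * (1 - Real.exp (-(lam / N))))⁻¹ *
            ((∫ β in (0 : ℝ)..lam,
                ∫ θ, expErr N P f θ ∂(Gibbs π (fun θ' => -(β * expErr N P f θ'))))
             + ∫ ω, KL (ρ ω) (Gibbs π (fun θ' => -(lam * empErr N f θ' ω))) ∂P))
    ∧ ((∫ β in (0 : ℝ)..lam,
          ∫ θ, expErr N P f θ ∂(Gibbs π (fun θ' => -(β * expErr N P f θ'))))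
        = -Real.log (∫ θ, Real.exp (-(lam * expErr N P f θ)) ∂π)) := by
  subst hP
  have hNpos : (0 : ℝ) < N := Nat.cast_pos.2 hN
  have hR := measurable_expErr (P := Measure.pi Ps) hf
  have hR01 := expErr_mem_Icc (P := Measure.pi Ps) hf
  have hRabs : ∀ θ, |expErr N (Measure.pi Ps) f θ| ≤ 1 := fun θ => by
    rw [abs_of_nonneg (hR01 θ).1]
    exact (hR01 θ).2
  have hr := measurable_empErr (N := N) hf
  have hu : Measurable (Function.uncurry fun θ ω => -(lam * empErr N f θ ω)) :=
    (hr.const_mul lam).neg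
  have huabs : ∀ θ ω, |-(lam * empErr N f θ ω)| ≤ lam := fun θ ω => by
    rw [abs_neg, abs_of_nonneg (mul_nonneg hlam.le (empErr_mem_Icc θ ω).1)]
    exact mul_le_of_le_one_right hlam.le (empErr_mem_Icc θ ω).2
  have hloc : (∫ β in (0 : ℝ)..lam, ∫ θ, expErr N (Measure.pi Ps) f θ
        ∂(Gibbs π (fun θ' => -(β * expErr N (Measure.pi Ps) f θ'))))
      = -Real.log (∫ θ, Real.exp (-(lam * expErr N (Measure.pi Ps) f θ)) ∂π) := by
    rw [← intervalIntegral_integral_tilted_neg hR hRabs]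
    congr 1
    ext β
    rw [gibbs_eq_tilted]
    refine integrable_exp_of_abs_le (C := |β| * 1) (hR.const_mul β).neg fun θ => ?_
    rw [abs_neg, abs_mul]
    exact mul_le_mul_of_nonneg_left (hRabs θ) (abs_nonneg β)
  have hGibbs : ∀ ω, Gibbs π (fun θ' => -(lam * empErr N f θ' ω))
      = π.tilted (fun θ' => -(lam * empErr N f θ' ω)) := fun ω =>
    gibbs_eq_tilted (integrable_exp_of_abs_le (hu.comp measurable_prodMk_right)
      fun θ => huabs θ ω)
  set c := 1 - Real.exp (-(lam / N)) with hc
  have hc0 : 0 < c := by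
    rw [hc, sub_pos, Real.exp_lt_one_iff, neg_lt_zero]
    positivity
  have hc1 : c < 1 := by linarith [Real.exp_pos (-(lam / N))]
  set L := ∫ β in (0 : ℝ)..lam, ∫ θ, expErr N (Measure.pi Ps) f θ
    ∂(Gibbs π (fun θ' => -(β * expErr N (Measure.pi Ps) f θ')))
  set K := ∫ ω, KL (ρ ω) (Gibbs π (fun θ' => -(lam * empErr N f θ' ω))) ∂(Measure.pi Ps) with hK
  set m := ∫ ω, ∫ θ, expErr N (Measure.pi Ps) f θ ∂(ρ ω) ∂(Measure.pi Ps) with hm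
  have hRρ : ∀ ω, Integrable (expErr N (Measure.pi Ps) f) (ρ ω) := fun ω =>
    integrable_of_abs_le hR hRabs
  have hRρint : Integrable (fun ω => ∫ θ, expErr N (Measure.pi Ps) f θ ∂(ρ ω)) (Measure.pi Ps) :=
    integrable_of_abs_le (C := 1) hR.stronglyMeasurable.integral_kernel.measurable fun ω => by
      simpa using norm_integral_le_of_norm_le_const (μ := ρ ω)
        (f := expErr N (Measure.pi Ps) f) (ae_of_all _ hRabs)
  have hm1 : m ≤ 1 := by
    have := integral_mono hRρint (integrable_const (1 : ℝ)) fun ω => by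
      simpa using integral_mono (hRρ ω) (integrable_const (1 : ℝ)) fun θ => (hR01 θ).2
    simpa using this
  have hcm : 0 < 1 - c * m := by nlinarith
  set A := -(N * Real.log (1 - c * m))
  set s := N * (c / (1 - c * m))
  have hs0 : 0 ≤ s := by positivity
  have hmean : ∫ ω, ∫ θ, (A + s * (expErr N (Measure.pi Ps) f θ - m)) ∂(ρ ω) ∂(Measure.pi Ps)
      = A := by
    simp only [integral_const_add_mul_sub (hRρ _), integral_const_add_mul_sub hRρint, ← hm,
      sub_self, mul_zero, add_zero]
  have hbound : ∀ θ, |A + s * (expErr N (Measure.pi Ps) f θ - m)| ≤ |A| + s * (1 + |m|) :=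
    fun θ => by
      refine (abs_add_le _ _).trans (add_le_add_right ?_ _)
      rw [abs_mul, abs_of_nonneg hs0]
      exact mul_le_mul_of_nonneg_left ((abs_sub _ _).trans (by linarith [hRabs θ])) hs0
  simp only [hGibbs, KLFin] at hρ
  simp only [hGibbs, KL] at hKLint hK
  have key := integral_posterior_add_log_le_integral_llr (P := Measure.pi Ps) (π := π) (ρ := ρ)
    hu (((hR.sub_const m).const_mul s).const_add A) huabs hbound
    (integral_exp_neg_mul_empErr_add_le_one hN hf hlam.le hc hcm) hρ hKLint
  have hU : ∀ θ, ∫ ω, -(lam * empErr N f θ ω) ∂(Measure.pi Ps)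
      = -(lam * expErr N (Measure.pi Ps) f θ) := fun θ => by
    rw [integral_neg, integral_const_mul, integral_empErr hf]
  simp only [hU] at key
  have hmain : A - L ≤ K := by
    rw [hK, hloc]
    simpa only [hmean, sub_neg_eq_add, llr] using key
  refine ⟨?_, ?_, hloc⟩
  · rw [le_div_iff₀ hc0, le_sub_comm, ← Real.le_log_iff_exp_le (by linarith)]
    have h1 : -(L + K) ≤ N * Real.log (1 - c * m) := by linarith
    calc -(N : ℝ)⁻¹ * L - (N : ℝ)⁻¹ * K = (N : ℝ)⁻¹ * -(L + K) := by ring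
      _ ≤ (N : ℝ)⁻¹ * (N * Real.log (1 - c * m)) :=
          mul_le_mul_of_nonneg_left h1 (inv_nonneg.2 hNpos.le)
      _ = Real.log (1 - c * m) := inv_mul_cancel_left₀ hNpos.ne' _
      _ = Real.log (1 - m * c) := by rw [mul_comm c]
  · rw [mul_inv_rev, mul_assoc, ← div_eq_inv_mul (b := c)]
    refine div_le_div_of_nonneg_right ?_ hc0.le
    linarith [Real.add_one_le_exp (-(N : ℝ)⁻¹ * L - (N : ℝ)⁻¹ * K)]
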